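/- For 0 ≤ i ≤ n, the dual Bernstein polynomials satisfy the differential-recurrence relation (1-x) d/dx D^n_i(x; α, β) - (n-i+α+1) D^n_i(x; α, β) = [(i-n)(i+β+1)/(i+1)] D^n_{i+1}(x; α, β) - A^{(α,β)}_{ni} [(n+α+1)/(i+1)] R^{(α,β+1)}_n(x), where A^{(α,β)}_{ni} = (-1)^{n-i}(n+1)(σ+1)_n / (K (α+1)_{n-i} (β+1)_i), σ = α+β+1, K = Γ(α+1)Γ(β+1)/Γ(σ+1), and D^n_{n+1} := 0. -/

import Mathlib

open scoped BigOperators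
open MeasureTheory Polynomial

/-- Pochhammer symbol `(c)_l = c (c+1) ⋯ (c+l-1)`. -/
noncomputable def poch (c : ℝ) (l : ℕ) : ℝ := ∏ j ∈ Finset.range l, (c + j)

/-- Shifted Jacobi polynomial `R_k^{(α,β)}(x)`. -/
noncomputable def jacobiR (α β : ℝ) (k : ℕ) (x : ℝ) : ℝ :=
  poch (α + 1) k / (Nat.factorial k) *
    ∑ l ∈ Finset.range (k + 1),
      poch (-(k : ℝ)) l * poch ((k : ℝ) + α + β + 1) l /
        (poch (α + 1) l * (Nat.factorial l)) * (1 - x) ^ l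

/-- Hahn polynomial `Q_k(x; α, β; N)`. -/
noncomputable def hahnQ (α β : ℝ) (N k : ℕ) (x : ℝ) : ℝ :=
  ∑ l ∈ Finset.range (k + 1),
    poch (-(k : ℝ)) l * poch ((k : ℝ) + α + β + 1) l * poch (-x) l /
      (poch (α + 1) l * poch (-(N : ℝ)) l * (Nat.factorial l))

/-- Bernstein basis polynomial `B^n_i(x)` as a real function. -/
noncomputable def bern (n i : ℕ) (x : ℝ) : ℝ :=
  (n.choose i : ℝ) * x ^ i * (1 - x) ^ (n - i)

/-- `D 0, …, D n` are the dual Bernstein polynomials of degree `n` with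
parameters `α, β`: they have degree at most `n` and are biorthogonal to the
Bernstein basis w.r.t. the weight `(1-x)^α x^β` on `[0,1]`. -/
def IsDualBernstein (n : ℕ) (α β : ℝ) (D : ℕ → Polynomial ℝ) : Prop :=
  (∀ j, j ≤ n → (D j).natDegree ≤ n) ∧
  ∀ i, i ≤ n → ∀ j, j ≤ n →
    (∫ x in (0:ℝ)..1, (1 - x) ^ α * x ^ β * bern n i x * (D j).eval x)
      = if i = j then (1:ℝ) else 0


lemma poch_zero' (c : ℝ) : poch c 0 = 1 := by simp [poch]

lemma poch_succ' (c : ℝ) (l : ℕ) : poch c (l+1) = poch c l * (c + l) := by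
  simp [poch, Finset.prod_range_succ]

lemma poch_succ_left (c : ℝ) (l : ℕ) : poch c (l+1) = c * poch (c+1) l := by
  simp only [poch, Finset.prod_range_succ']
  rw [mul_comm]
  congr 1
  · simp
  · apply Finset.prod_congr rfl
    intro j _
    push_cast; ring

lemma poch_add' (c : ℝ) (k l : ℕ) : poch c (k+l) = poch c k * poch (c+k) l := by
  induction l with
  | zero => simp [poch_zero']
  | succ l ih =>
    rw [← add_assoc, poch_succ', poch_succ', ih]; push_cast; ring

lemma poch_pos' {c : ℝ} (hc : 0 < c) (l : ℕ) : 0 < poch c l := by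
  unfold poch
  apply Finset.prod_pos
  intro j _
  positivity

lemma poch_neg_eq_zero (n l : ℕ) (h : n < l) : poch (-(n:ℝ)) l = 0 := by
  unfold poch
  apply Finset.prod_eq_zero (Finset.mem_range.mpr h)
  ring

lemma poch_reflect (c : ℝ) (l : ℕ) : poch c l = (-1)^l * poch (1 - c - l) l := by
  induction l generalizing c with
  | zero => simp [poch_zero']
  | succ l ih =>
    rw [poch_succ', poch_succ_left (1 - c - _), ih]
    have : (1 - c - ((l+1 : ℕ):ℝ) + 1) = 1 - c - l := by push_cast; ring
    rw [this]; push_cast; ring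

lemma gamma_poch {c : ℝ} (hc : 0 < c) (l : ℕ) : Real.Gamma (c + l) = poch c l * Real.Gamma c := by
  induction l with
  | zero => simp [poch_zero']
  | succ l ih =>
    have h : c + l ≠ 0 := by positivity
    have : c + ((l+1:ℕ):ℝ) = (c + l) + 1 := by push_cast; ring
    rw [this, Real.Gamma_add_one h, ih, poch_succ']; ring

/-- Chu–Vandermonde. -/
lemma chuV (m : ℕ) : ∀ (N : ℕ) (b c : ℝ), m < N → 0 < c →
    ∑ l ∈ Finset.range N, poch (-(m:ℝ)) l * poch b l / (poch c l * (Nat.factorial l))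
      = poch (c - b) m / poch c m := by
  induction m with
  | zero =>
    intro N b c hN hc
    rw [Finset.sum_eq_single 0]
    · simp [poch_zero']
    · intro l _ hl
      rw [poch_neg_eq_zero 0 l (by omega)]; simp
    · intro h; simp at h; omega
  | succ m ih =>
    intro N b c hN hc
    have h1 := ih N b c (by omega) hc
    obtain ⟨M, rfl⟩ : ∃ M, N = M + 1 := ⟨N - 1, by omega⟩
    have h2 := ih M (b+1) (c+1) (by omega) (by linarith)
    have key : ∑ l ∈ Finset.range (M+1), poch (-((m+1:ℕ):ℝ)) l * poch b l / (poch c l * (Nat.factorial l))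
       - ∑ l ∈ Finset.range (M+1), poch (-(m:ℝ)) l * poch b l / (poch c l * (Nat.factorial l))
       = -(b/c) * ∑ l ∈ Finset.range M, poch (-(m:ℝ)) l * poch (b+1) l / (poch (c+1) l * (Nat.factorial l)) := by
      rw [← Finset.sum_sub_distrib, Finset.sum_range_succ', Finset.mul_sum]
      simp only [poch_zero', sub_self, add_zero]
      apply Finset.sum_congr rfl
      intro l _
      have e1 : poch (-((m+1:ℕ):ℝ)) (l+1) = -((m:ℝ)+1) * poch (-(m:ℝ)) l := by
        rw [poch_succ_left]
        have : -((m+1:ℕ):ℝ) + 1 = -(m:ℝ) := by push_cast; ring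
        rw [this]; push_cast; ring
      rw [e1, poch_succ' (-(m:ℝ)), poch_succ_left b, poch_succ_left c, Nat.factorial_succ]
      have := (poch_pos' (show 0 < c+1 by linarith) l).ne'
      have : (Nat.factorial l : ℝ) ≠ 0 := by positivity
      push_cast
      field_simp
      ring
    rw [h1, h2] at key
    have e3 : poch (c+1-(b+1)) m = poch (c-b) m := by congr 1; ring
    rw [e3] at key
    have p1 := (poch_pos' hc m).ne'
    have p2 := (poch_pos' (show 0 < c+1 by linarith) m).ne'
    have p4 : c + m ≠ 0 := by positivity
    have p3 : poch c m * (c + m) = c * poch (c+1) m := by rw [← poch_succ', poch_succ_left]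
    have e4 : poch (c+1) m = poch c m * (c+m) / c := by rw [p3]; field_simp
    rw [poch_succ' (c-b), poch_succ' c, eq_add_of_sub_eq key, e4]
    field_simp
    ring

lemma choose_poch (n i : ℕ) (hi : i ≤ n) (l : ℕ) (hl : l ≤ n) :
    poch (-(n:ℝ)) l * ((n-l).choose i : ℝ) = (n.choose i : ℝ) * poch (-((n-i : ℕ):ℝ)) l := by
  induction l with
  | zero => simp [poch_zero']
  | succ l ih =>
    have ih := ih (by omega)
    obtain ⟨k, hk⟩ : ∃ k, n - l = k + 1 := ⟨n - l - 1, by omega⟩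
    have hk' : n - (l+1) = k := by omega
    have hn : (n:ℝ) = k + 1 + l := by have : n = k+1+l := by omega
                                      exact_mod_cast this
    rw [hk] at ih
    rw [hk', poch_succ', poch_succ', ← mul_assoc, ← ih]
    rcases le_or_gt i (k+1) with h | h
    · have c := Nat.choose_mul_succ_eq k i
      have c' : (k.choose i : ℝ) * (k+1) = ((k+1).choose i : ℝ) * (k+1-i) := by
        have := congrArg (Nat.cast (R := ℝ)) c
        push_cast [Nat.cast_sub h] at this
        exact this
      push_cast [Nat.cast_sub hi]
      rw [hn]
      linear_combination (-poch (-((k:ℝ)+1+l)) l) * c'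
    · rw [Nat.choose_eq_zero_of_lt h, Nat.choose_eq_zero_of_lt (show k < i by omega)]; simp

lemma bern_span (n : ℕ) (p : ℝ[X]) (hp : p.natDegree ≤ n) :
    ∃ s : ℕ → ℝ, p = ∑ j ∈ Finset.range (n+1), C (s j) * (X^j * (1-X)^(n-j)) := by
  let S : Submodule ℝ ℝ[X] := Submodule.span ℝ (Set.range (fun j : Fin (n+1) => (X^(j:ℕ) * (1-X)^(n-j) : ℝ[X])))
  have hX : ∀ k ≤ n, (X^k : ℝ[X]) ∈ S := by
    intro k hk
    have : (X^k : ℝ[X]) = ∑ m ∈ Finset.range (n-k+1), ((n-k).choose m : ℝ) • (X^(k+m) * (1-X)^(n-(k+m))) := by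
      have h : (X^k : ℝ[X]) = X^k * (X + (1-X))^(n-k) := by simp
      rw [add_pow, Finset.mul_sum] at h
      rw [h]
      apply Finset.sum_congr rfl
      intro m _
      rw [Polynomial.smul_eq_C_mul, Nat.sub_add_eq, pow_add, Polynomial.C_eq_natCast]
      ring
    rw [this]
    apply Submodule.sum_mem
    intro m hm
    apply Submodule.smul_mem
    simp at hm
    exact Submodule.subset_span ⟨⟨k+m, by omega⟩, rfl⟩
  have hpS : p ∈ S := by
    rw [Polynomial.as_sum_range_C_mul_X_pow' p (n := n+1) (by omega : p.natDegree < n+1)]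
    apply Submodule.sum_mem
    intro k hk
    rw [← Polynomial.smul_eq_C_mul]
    exact Submodule.smul_mem _ _ (hX k (by simp at hk; omega))
  obtain ⟨c, hc⟩ := (Submodule.mem_span_range_iff_exists_fun ℝ).mp hpS
  refine ⟨fun j => if h : j < n+1 then c ⟨j, h⟩ else 0, ?_⟩
  rw [← hc, Finset.sum_range]
  apply Finset.sum_congr rfl
  intro j _
  beta_reduce
  rw [dif_pos j.isLt, Polynomial.smul_eq_C_mul]

lemma beta_integrable {α β : ℝ} (hα : α > -1) (hβ : β > -1) :
    IntervalIntegrable (fun x : ℝ => (1-x)^α * x^β) volume 0 1 := by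
  have h := Complex.betaIntegral_convergent (u := ((β+1 : ℝ) : ℂ)) (v := ((α+1 : ℝ) : ℂ))
    (by simp; linarith) (by simp; linarith)
  rw [intervalIntegrable_iff_integrableOn_Ioc_of_le (by norm_num)] at h ⊢
  have h2 := h.re
  refine IntegrableOn.congr_fun h2 ?_ measurableSet_Ioc
  intro x hx
  have e1 : (((β+1 : ℝ) : ℂ) - 1) = ((β : ℝ) : ℂ) := by push_cast; ring
  have e2 : (((α+1 : ℝ) : ℂ) - 1) = ((α : ℝ) : ℂ) := by push_cast; ring
  have e3 : (1 - (x:ℂ)) = ((1 - x : ℝ) : ℂ) := by push_cast; ring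
  simp only [e1, e2, e3]
  rw [← Complex.ofReal_cpow hx.1.le, ← Complex.ofReal_cpow (by linarith [hx.2]), ← Complex.ofReal_mul]
  simp [mul_comm]

lemma beta_value {α β : ℝ} (hα : α > -1) (hβ : β > -1) :
    ∫ x in (0:ℝ)..1, (1-x)^α * x^β = Real.Gamma (α+1) * Real.Gamma (β+1) / Real.Gamma (α+β+2) := by
  have h := ProbabilityTheory.beta_eq_betaIntegralReal (β+1) (α+1) (by linarith) (by linarith)
  have : Complex.betaIntegral ((β+1 : ℝ) : ℂ) ((α+1 : ℝ) : ℂ) = ((∫ x in (0:ℝ)..1, (1-x)^α * x^β : ℝ) : ℂ) := by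
    rw [Complex.betaIntegral, ← intervalIntegral.integral_ofReal]
    apply intervalIntegral.integral_congr
    intro x hx
    rw [Set.uIcc_of_le (by norm_num)] at hx
    have e1 : (((β+1 : ℝ) : ℂ) - 1) = ((β : ℝ) : ℂ) := by push_cast; ring
    have e2 : (((α+1 : ℝ) : ℂ) - 1) = ((α : ℝ) : ℂ) := by push_cast; ring
    have e3 : (1 - (x:ℂ)) = ((1 - x : ℝ) : ℂ) := by push_cast; ring
    simp only [e1, e2, e3]
    rw [← Complex.ofReal_cpow hx.1, ← Complex.ofReal_cpow (by linarith [hx.2]), ← Complex.ofReal_mul, mul_comm]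
  rw [this, Complex.ofReal_re] at h
  rw [← h, ProbabilityTheory.beta]
  rw [show β + 1 + (α + 1) = α+β+2 by ring, mul_comm]

/-- The integration functional exists as a linear map, with explicit moments. -/
lemma exists_functional {α β : ℝ} (hα : α > -1) (hβ : β > -1) :
    ∃ L : ℝ[X] →ₗ[ℝ] ℝ,
      (∀ p : ℝ[X], L p = ∫ x in (0:ℝ)..1, (1-x)^α * x^β * p.eval x) ∧
      (∀ a b : ℕ, L (X^a * (1-X)^b) =
        (Real.Gamma (α+1) * Real.Gamma (β+1) / Real.Gamma (α+β+2)) *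
          (poch (α+1) b * poch (β+1) a / poch (α+β+2) (a+b))) := by
  have hint : ∀ p : ℝ[X], IntervalIntegrable (fun x : ℝ => (1-x)^α * x^β * p.eval x) volume 0 1 := by
    intro p
    exact (beta_integrable hα hβ).mul_continuousOn p.continuous.continuousOn
  refine ⟨{ toFun := fun p => ∫ x in (0:ℝ)..1, (1-x)^α * x^β * p.eval x, map_add' := ?_, map_smul' := ?_ }, fun p => rfl, ?_⟩
  · intro p q
    rw [← intervalIntegral.integral_add (hint p) (hint q)]
    simp [mul_add]
  · intro c p
    simp only [RingHom.id_apply, smul_eq_mul]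
    rw [← intervalIntegral.integral_const_mul]
    congr 1
    ext x
    simp
    ring
  · intro a b
    simp only [LinearMap.coe_mk, AddHom.coe_mk]
    have e : ∫ x in (0:ℝ)..1, (1-x)^α * x^β * (X^a * (1-X)^b : ℝ[X]).eval x
        = ∫ x in (0:ℝ)..1, (1-x)^(α+b) * x^(β+a) := by
      apply intervalIntegral.integral_congr_ae
      have h1 : ∀ᵐ x : ℝ, x ≠ 1 := by simp [ae_iff]
      filter_upwards [h1] with x hx1 hx
      rw [Set.uIoc_of_le (by norm_num)] at hx
      have h2 : 0 < 1 - x := by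
        rcases lt_or_eq_of_le hx.2 with h | h
        · linarith
        · exact absurd h hx1
      rw [Real.rpow_add h2, Real.rpow_add hx.1, Real.rpow_natCast, Real.rpow_natCast]
      simp
      ring
    have hb : (0:ℝ) ≤ b := by positivity
    have ha : (0:ℝ) ≤ a := by positivity
    rw [e, beta_value (by linarith) (by linarith)]
    rw [show α + b + 1 = (α+1) + b by ring, show β + a + 1 = (β+1) + a by ring,
      show α + b + (β + a) + 2 = (α+β+2) + ((a+b : ℕ):ℝ) by push_cast; ring,
      gamma_poch (by linarith), gamma_poch (by linarith), gamma_poch (by linarith)]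
    have := (poch_pos' (show 0 < α+β+2 by linarith) (a+b)).ne'
    have := (Real.Gamma_pos_of_pos (show 0 < α+β+2 by linarith)).ne'
    field_simp

/-- Pearson equation for the functional. -/
lemma pearson {α β K : ℝ} (hα : α > -1) (hβ : β > -1) (L : ℝ[X] →ₗ[ℝ] ℝ)
    (hL : ∀ a b : ℕ, L (X^a * (1-X)^b) = K * (poch (α+1) b * poch (β+1) a / poch (α+β+2) (a+b)))
    (p : ℝ[X]) : L (X * (1-X) * derivative p) = L ((C (α+β+2) * X - C (β+1)) * p) := by
  have hm : ∀ a : ℕ, L (X^a) = K * (poch (β+1) a / poch (α+β+2) a) := by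
    intro a
    have := hL a 0
    simpa [poch_zero'] using this
  induction p using Polynomial.induction_on' with
  | add p q hp hq => rw [derivative_add, mul_add, mul_add, map_add, map_add, hp, hq]
  | monomial a c =>
    have e1 : X * (1-X) * derivative (monomial a c : ℝ[X]) = (c * a) • (X^a - X^(a+1) : ℝ[X]) := by
      rw [derivative_monomial, smul_eq_C_mul, ← C_mul_X_pow_eq_monomial]
      rcases a with _ | a
      · simp
      · simp only [Nat.add_sub_cancel]; ring
    have e2 : (C (α+β+2) * X - C (β+1)) * (monomial a c : ℝ[X]) = (c * (α+β+2)) • (X^(a+1) : ℝ[X]) - (c * (β+1)) • (X^a : ℝ[X]) := by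
      rw [smul_eq_C_mul, smul_eq_C_mul, ← C_mul_X_pow_eq_monomial, C_mul, C_mul]; ring
    rw [e1, e2, map_smul, map_sub, map_sub, map_smul, map_smul, hm, hm, poch_succ', poch_succ']
    have h1 := (poch_pos' (show 0 < α+β+2 by linarith) a).ne'
    have h2 : α+β+2+a ≠ 0 := by
      have : (0:ℝ) ≤ a := by positivity
      have : 0 < α+β+2+a := by linarith
      exact this.ne'
    simp only [smul_eq_mul]
    field_simp
    ring

noncomputable def Fpoly (n : ℕ) (b c : ℝ) : ℝ[X] :=
  ∑ l ∈ Finset.range (n+1),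
    C (poch (-(n:ℝ)) l * poch b l / (poch c l * (Nat.factorial l))) * (1-X)^l

lemma Fpoly_natDegree (n : ℕ) (b c : ℝ) : (Fpoly n b c).natDegree ≤ n := by
  apply Polynomial.natDegree_sum_le_of_forall_le
  intro l hl
  have hl : l ≤ n := by simp at hl; omega
  refine (natDegree_C_mul_le _ _).trans ?_
  refine natDegree_pow_le.trans ?_
  have : (1 - X : ℝ[X]).natDegree ≤ 1 := by
    refine (natDegree_sub_le _ _).trans ?_
    simp
  calc l * (1 - X : ℝ[X]).natDegree ≤ l * 1 := Nat.mul_le_mul_left _ this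
    _ ≤ n := by omega

lemma Fpoly_eval_one (n : ℕ) (b c : ℝ) : (Fpoly n b c).eval 1 = 1 := by
  rw [Fpoly, eval_finsetSum, Finset.sum_eq_single 0]
  · simp [poch_zero']
  · intro l _ hl
    simp [hl]
  · simp

lemma Fpoly_eval_zero (n : ℕ) (b c : ℝ) (hc : 0 < c) :
    (Fpoly n b c).eval 0 = poch (c-b) n / poch c n := by
  rw [Fpoly, eval_finsetSum, ← chuV n (n+1) b c (by omega) hc]
  simp

lemma Fpoly_moment {α β K : ℝ} (hα : α > -1) (hβ : β > -1) (L : ℝ[X] →ₗ[ℝ] ℝ)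
    (hL : ∀ a b : ℕ, L (X^a * (1-X)^b) = K * (poch (α+1) b * poch (β+1) a / poch (α+β+2) (a+b)))
    (n : ℕ) (c : ℝ) (hc : 0 < c) (j : ℕ) (hj : j ≤ n) :
    L (Fpoly n (n+α+β+2) c * (X^j * (1-X)^(n-j))) =
      K * (poch (α+1) (n-j) * poch (β+1) j / poch (α+β+2) n) *
        (poch (c - (α+1+(n-j : ℕ))) n / poch c n) := by
  rw [← chuV n (n+1) _ c (by omega) hc, Fpoly, Finset.sum_mul, map_sum, Finset.mul_sum]
  apply Finset.sum_congr rfl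
  intro l _
  have e : C (poch (-(n:ℝ)) l * poch (n+α+β+2) l / (poch c l * (Nat.factorial l))) * (1-X)^l * (X^j * (1-X)^(n-j))
     = (poch (-(n:ℝ)) l * poch (n+α+β+2) l / (poch c l * (Nat.factorial l))) • (X^j * (1-X)^(n-j+l) : ℝ[X]) := by
    rw [smul_eq_C_mul]; ring
  rw [e, map_smul, hL, poch_add', show j + (n-j+l) = n + l by omega, poch_add' _ n l,
    show α+β+2+(n:ℝ) = n+α+β+2 by ring]
  have h1 := (poch_pos' (show 0 < α+β+2 by linarith) n).ne'
  have h2 := (poch_pos' (show 0 < n+α+β+2 by have : (0:ℝ) ≤ n := by positivity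
                                             linarith) l).ne'
  have h3 := (poch_pos' hc l).ne'
  have : (Nat.factorial l : ℝ) ≠ 0 := by positivity
  simp only [smul_eq_mul]
  field_simp

lemma one_sub_pow_expand (n l : ℕ) (hl : l ≤ n) :
    ((1-X)^l : ℝ[X]) = ∑ m ∈ Finset.range (n+1), ((n-l).choose m : ℝ) • (X^m * (1-X)^(n-m)) := by
  have h : ((1-X)^l : ℝ[X]) = (1-X)^l * (X + (1-X))^(n-l) := by simp
  rw [add_pow, Finset.mul_sum] at h
  rw [h]
  have : Finset.range (n-l+1) ⊆ Finset.range (n+1) := by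
    intro a; simp; omega
  rw [← Finset.sum_subset this]
  · apply Finset.sum_congr rfl
    intro m hm
    have hm : m ≤ n-l := by simp at hm; omega
    rw [Polynomial.smul_eq_C_mul, Polynomial.C_eq_natCast, show n - m = (n-l-m) + l by omega, pow_add]
    ring
  · intro m _ hm
    have hm : n - l < m := by simp at hm; omega
    rw [Nat.choose_eq_zero_of_lt hm]; simp

/-- pairing of `Fpoly` with the dual polynomial. -/
lemma Fpoly_dual (L : ℝ[X] →ₗ[ℝ] ℝ) (n : ℕ) (b c : ℝ) (hc : 0 < c) (i : ℕ) (hi : i ≤ n) (d : ℝ[X])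
    (hd : ∀ j ≤ n, L (d * (X^j * (1-X)^(n-j))) = if j = i then 1 / (n.choose i : ℝ) else 0) :
    L (d * Fpoly n b c) = poch (c-b) (n-i) / poch c (n-i) := by
  have hch : (n.choose i : ℝ) ≠ 0 := by exact_mod_cast (Nat.choose_pos hi).ne'
  rw [← chuV (n-i) (n+1) b c (by omega) hc, Fpoly, Finset.mul_sum, map_sum]
  apply Finset.sum_congr rfl
  intro l hl
  have hl : l ≤ n := by simp at hl; omega
  have h1 : L (d * (1-X)^l) = ((n-l).choose i : ℝ) / n.choose i := by
    rw [one_sub_pow_expand n l hl, Finset.mul_sum, map_sum, Finset.sum_eq_single i]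
    · rw [mul_smul_comm, map_smul, hd i hi]; simp [div_eq_mul_inv]
    · intro m hm hmi
      rw [mul_smul_comm, map_smul, hd m (by simp at hm; omega), if_neg hmi]; simp
    · intro h; simp at h; omega
  have h2 : d * (C (poch (-(n:ℝ)) l * poch b l / (poch c l * (Nat.factorial l))) * (1-X)^l)
     = (poch (-(n:ℝ)) l * poch b l / (poch c l * (Nat.factorial l))) • (d * (1-X)^l) := by
    rw [smul_eq_C_mul]; ring
  rw [h2, map_smul, h1]
  have := choose_poch n i hi l hl
  have h3 := (poch_pos' hc l).ne'
  have : (Nat.factorial l : ℝ) ≠ 0 := by positivity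
  simp only [smul_eq_mul]
  field_simp
  linear_combination (poch b l) * choose_poch n i hi l hl

/-- value at one as a pairing. -/
lemma pair_eval_one (L : ℝ[X] →ₗ[ℝ] ℝ) (n : ℕ) (E : ℝ[X]) (t : ℝ)
    (hE : ∀ j ≤ n, L (E * (X^j * (1-X)^(n-j))) = if j = n then t else 0) (p : ℝ[X])
    (hp : p.natDegree ≤ n) : L (p * E) = t * p.eval 1 := by
  obtain ⟨s, hs⟩ := bern_span n p hp
  rw [hs, Finset.sum_mul, map_sum, eval_finsetSum, Finset.mul_sum]
  apply Finset.sum_congr rfl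
  intro j hj
  have hj : j ≤ n := by simp at hj; omega
  rw [show C (s j) * (X^j * (1-X)^(n-j)) * E = s j • (E * (X^j * (1-X)^(n-j))) by
    rw [smul_eq_C_mul]; ring, map_smul, hE j hj]
  split_ifs with h
  · subst h; simp; ring
  · have : n - j ≠ 0 := by omega
    simp [this]

lemma pair_eval_zero (L : ℝ[X] →ₗ[ℝ] ℝ) (n : ℕ) (E : ℝ[X])
    (hE : ∀ j ≤ n, 1 ≤ j → L (E * (X^j * (1-X)^(n-j))) = 0) (p : ℝ[X])
    (hp : p.natDegree ≤ n) : L (E * p) = L (E * (1-X)^n) * p.eval 0 := by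
  obtain ⟨s, hs⟩ := bern_span n p hp
  rw [hs, Finset.mul_sum, map_sum, eval_finsetSum, Finset.mul_sum]
  apply Finset.sum_congr rfl
  intro j hj
  have hj : j ≤ n := by simp at hj; omega
  rw [show E * (C (s j) * (X^j * (1-X)^(n-j))) = s j • (E * (X^j * (1-X)^(n-j))) by
    rw [smul_eq_C_mul]; ring, map_smul]
  rcases Nat.eq_zero_or_pos j with h | h
  · subst h; simp [mul_comm]
  · rw [hE j hj h]
    have : j ≠ 0 := by omega
    simp [this]

/-- the key adjoint computation. -/
lemma adjoint_comp {α β K : ℝ} (hα : α > -1) (hβ : β > -1) (L : ℝ[X] →ₗ[ℝ] ℝ)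
    (hL : ∀ a b : ℕ, L (X^a * (1-X)^b) = K * (poch (α+1) b * poch (β+1) a / poch (α+β+2) (a+b)))
    (n i k : ℕ) (hk : k + 1 ≤ n) (d : ℝ[X]) :
    L (((1-X) * derivative d - C ((n:ℝ) - i + α + 1) * d) * (X^(k+1) * (1-X)^(n-(k+1))))
      = ((i:ℝ) - (k+1)) * L (d * (X^(k+1) * (1-X)^(n-(k+1))))
        - (β + k + 1) * L (d * (X^k * (1-X)^(n-k))) := by
  obtain ⟨m, rfl⟩ : ∃ m, n = k + 1 + m := ⟨n - (k+1), by omega⟩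
  rw [show k + 1 + m - (k+1) = m by omega, show k + 1 + m - k = m + 1 by omega]
  have hP := pearson hα hβ L hL (d * (X^k * (1-X)^m))
  have hder : X * (1-X) * derivative (X^k * (1-X)^m : ℝ[X]) =
      (C (k:ℝ) * (1-X) - C (m:ℝ) * X) * (X^k * (1-X)^m) := by
    rw [derivative_mul, derivative_pow, derivative_pow]
    rcases k with _ | k <;> rcases m with _ | m <;> simp <;> ring
  have e1 : X * (1-X) * derivative (d * (X^k * (1-X)^m)) =
      (1-X) * derivative d * (X^(k+1) * (1-X)^m) + d * ((C (k:ℝ) * (1-X) - C (m:ℝ) * X) * (X^k * (1-X)^m)) := by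
    rw [derivative_mul, mul_add, ← hder]; ring
  rw [e1, map_add] at hP
  have e2 : ((1-X) * derivative d - C (((k+1+m:ℕ):ℝ) - i + α + 1) * d) * (X^(k+1) * (1-X)^m)
     = (1-X) * derivative d * (X^(k+1) * (1-X)^m) - C (((k+1+m:ℕ):ℝ) - i + α + 1) * d * (X^(k+1) * (1-X)^m) := by ring
  rw [e2, map_sub, eq_sub_of_add_eq hP, ← map_sub, ← map_sub, ← smul_eq_mul ((i:ℝ) - (k+1)), ← smul_eq_mul (β + k + 1), ← map_smul, ← map_smul, ← map_sub]
  congr 1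
  rw [smul_eq_C_mul, smul_eq_C_mul]
  simp only [map_sub, map_add, map_one, Nat.cast_add, Nat.cast_one, map_natCast]
  rw [show (C 2 : ℝ[X]) = 2 from rfl]
  ring

lemma jacobiR_eq (n : ℕ) (α β x : ℝ) :
    jacobiR α (β+1) n x = poch (α+1) n / (Nat.factorial n) * (Fpoly n (n+α+β+2) (α+1)).eval x := by
  rw [jacobiR, Fpoly, eval_finsetSum]
  congr 1
  apply Finset.sum_congr rfl
  intro l _
  rw [show (n:ℝ) + α + (β+1) + 1 = n+α+β+2 by ring]
  simp

lemma poch_shift_eq_zero (n j : ℕ) (h : j < n) : poch (-(j:ℝ)) n = 0 := poch_neg_eq_zero j n h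

/-- Explicit value of the dual polynomials at `1`. -/
lemma dual_eval_one {α β K : ℝ} (hα : α > -1) (hβ : β > -1) (hK : 0 < K) (L : ℝ[X] →ₗ[ℝ] ℝ)
    (hL : ∀ a b : ℕ, L (X^a * (1-X)^b) = K * (poch (α+1) b * poch (β+1) a / poch (α+β+2) (a+b)))
    (n : ℕ) :
    ∃ E : ℝ[X], ∃ t : ℝ, t = K * (poch (β+1) n / poch (α+β+2) n) * (Nat.factorial n / poch (α+2) n) ∧ 0 < t ∧
      E.natDegree ≤ n ∧ E.eval 0 ≠ 0 ∧
      (∀ p : ℝ[X], p.natDegree ≤ n → L (p * E) = t * p.eval 1) ∧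
      (∀ i ≤ n, ∀ d : ℝ[X], (∀ j ≤ n, L (d * (X^j * (1-X)^(n-j))) = if j = i then 1 / (n.choose i : ℝ) else 0) →
        L (d * E) = (-1)^(n-i) * poch (β+i+1) (n-i) / poch (α+2) (n-i)) := by
  have hc : 0 < α + 2 := by linarith
  have hn0 : (0:ℝ) ≤ n := by positivity
  have p1 := poch_pos' (show 0 < β+1 by linarith) n
  have p2 := poch_pos' (show 0 < α+β+2 by linarith) n
  have p3 := poch_pos' hc n
  refine ⟨Fpoly n (n+α+β+2) (α+2), _, rfl, by positivity, Fpoly_natDegree _ _ _, ?_, ?_, ?_⟩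
  · rw [Fpoly_eval_zero _ _ _ hc, poch_reflect]
    have := poch_pos' (show 0 < β+1 by linarith) n
    rw [show 1 - (α + 2 - (n+α+β+2)) - n = β + 1 by ring]
    have : ((-1:ℝ))^n ≠ 0 := by simp
    positivity
  · intro p hp
    apply pair_eval_one L n _ _ _ p hp
    intro j hj
    rw [Fpoly_moment hα hβ L hL n _ hc j hj]
    split_ifs with h
    · subst h
      have : poch (α + 2 - (α + 1 + ((j - j : ℕ):ℝ))) j = Nat.factorial j := by
        rw [show α + 2 - (α + 1 + ((j - j : ℕ):ℝ)) = 1 by simp; ring]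
        clear * -
        induction j with
        | zero => simp [poch_zero']
        | succ j ih => rw [poch_succ', ih, Nat.factorial_succ]; push_cast; ring
      rw [this]; simp [poch_zero']
    · have : α + 2 - (α + 1 + ((n - j : ℕ):ℝ)) = -((n-j-1 : ℕ) : ℝ) := by
        rw [Nat.cast_sub (show 1 ≤ n - j by omega)]; push_cast; ring
      rw [this, poch_neg_eq_zero _ _ (by omega)]; simp
  · intro i hi d hd
    rw [Fpoly_dual L n _ _ hc i hi d hd, poch_reflect]
    congr 3
    push_cast [Nat.cast_sub hi]; ring

/-- Differential-recurrence relation (Theorem 3.2 of the paper). -/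
theorem dualBernstein_diffRec_I (n : ℕ) (α β : ℝ) (hα : α > -1) (hβ : β > -1)
    (D : ℕ → Polynomial ℝ) (hD : IsDualBernstein n α β D)
    (i : ℕ) (hi : i ≤ n) (x : ℝ) :
    (1-x) * (Polynomial.derivative (D i)).eval x
        - ((n:ℝ) - i + α + 1) * (D i).eval x
      = (((i:ℝ)-n)*((i:ℝ)+β+1)/((i:ℝ)+1)) * (D (i+1)).eval x
        - ((-1)^(n-i) * ((n:ℝ)+1) * poch (α+β+2) n /
      ((Real.Gamma (α+1) * Real.Gamma (β+1) / Real.Gamma (α+β+2)) * poch (α+1) (n-i) * poch (β+1) i)) * (((n:ℝ)+α+1)/((i:ℝ)+1)) * jacobiR α (β+1) n x := by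
  obtain ⟨L, hLi, hL⟩ := exists_functional hα hβ
  have hK : 0 < Real.Gamma (α+1) * Real.Gamma (β+1) / Real.Gamma (α+β+2) := by
    have := Real.Gamma_pos_of_pos (show 0 < α+1 by linarith)
    have := Real.Gamma_pos_of_pos (show 0 < β+1 by linarith)
    have := Real.Gamma_pos_of_pos (show 0 < α+β+2 by linarith)
    positivity
  generalize Real.Gamma (α+1) * Real.Gamma (β+1) / Real.Gamma (α+β+2) = K at *
  -- biorthogonality
  have hd : ∀ k ≤ n, ∀ j ≤ n, L (D k * (X^j * (1-X)^(n-j))) = if j = k then 1 / (n.choose k : ℝ) else 0 := by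
    intro k hk j hj
    have h := hD.2 j hj k hk
    have hch : (n.choose j : ℝ) ≠ 0 := by exact_mod_cast (Nat.choose_pos hj).ne'
    have e : ∫ x in (0:ℝ)..1, (1 - x) ^ α * x ^ β * bern n j x * (D k).eval x
        = n.choose j * L (D k * (X^j * (1-X)^(n-j))) := by
      rw [hLi, ← intervalIntegral.integral_const_mul]
      congr 1
      ext y
      simp [bern]
      ring
    rw [e] at h
    split_ifs at h ⊢ with hjk
    · subst hjk; field_simp; linarith
    · simpa [hch] using h
  have hdeg := hD.1
  -- replace `D (i+1)` by zero when `i = n`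
  obtain ⟨d', hd'x, hd'deg, hd', hd'1⟩ : ∃ d' : ℝ[X],
      (((i:ℝ)-n) * (D (i+1)).eval x = ((i:ℝ)-n) * d'.eval x) ∧ d'.natDegree ≤ n ∧
      (∀ j ≤ n, ((i:ℝ)-n) * L (d' * (X^j * (1-X)^(n-j))) = ((i:ℝ)-n) * if j = i+1 then 1 / (n.choose (i+1) : ℝ) else 0)
      ∧ (i = n ∨ (i + 1 ≤ n ∧ d' = D (i+1))) := by
    rcases Nat.lt_or_ge i n with h | h
    · exact ⟨D (i+1), rfl, hdeg _ h, fun j hj => by rw [hd _ h j hj], Or.inr ⟨h, rfl⟩⟩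
    · have : i = n := by omega
      subst this
      exact ⟨0, by simp, by simp, by simp, Or.inl rfl⟩
  obtain ⟨E, t, ht, htpos, hEdeg, hE0, hE1, hEd⟩ := dual_eval_one hα hβ hK L hL n
  have hi0 : (0:ℝ) ≤ i := by positivity
  have hn0 : (0:ℝ) ≤ n := by positivity
  have hi1 : (i:ℝ) + 1 ≠ 0 := by positivity
  set c : ℝ := (((i:ℝ)-n)*((i:ℝ)+β+1)/((i:ℝ)+1)) with hc
  set A : ℝ := ((-1)^(n-i) * ((n:ℝ)+1) * poch (α+β+2) n / (K * poch (α+1) (n-i) * poch (β+1) i)) * (((n:ℝ)+α+1)/((i:ℝ)+1)) * (poch (α+1) n / (Nat.factorial n)) with hA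
  set F := Fpoly n (n+α+β+2) (α+1) with hF
  set S : ℝ[X] := ((1-X) * derivative (D i) - C ((n:ℝ) - i + α + 1) * D i) - C c * d' + C A * F with hS
  suffices hS0 : S = 0 by
    have := congrArg (eval x) hS0
    simp only [hS, eval_add, eval_sub, eval_mul, eval_C, eval_one, eval_X, eval_zero] at this
    rw [jacobiR_eq, ← hF]
    have hcx : c * (D (i+1)).eval x = c * d'.eval x := by
      rw [hc]; linear_combination (((i:ℝ)+β+1)/((i:ℝ)+1)) * hd'x
    rw [hcx]
    rw [hA] at this
    linear_combination this
  have hSdeg : S.natDegree ≤ n := by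
    have hsub : ∀ p q : ℝ[X], p.natDegree ≤ n → q.natDegree ≤ n → (p - q).natDegree ≤ n :=
      fun p q hp hq => (natDegree_sub_le p q).trans (max_le hp hq)
    refine natDegree_add_le_of_degree_le (hsub _ _ (hsub _ _ ?_ ?_) ?_) ?_
    · rcases Nat.eq_zero_or_pos n with h | h
      · have : (D i).natDegree = 0 := by have := hdeg i hi; omega
        rw [natDegree_eq_zero.mp this |>.choose_spec.symm]; simp
      · refine natDegree_mul_le.trans ?_
        have h1 : (1 - X : ℝ[X]).natDegree ≤ 1 := by
          refine (natDegree_sub_le _ _).trans ?_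
          simp
        have h2 := natDegree_derivative_le (D i)
        have h3 := hdeg i hi
        omega
    · exact (natDegree_C_mul_le _ _).trans (hdeg i hi)
    · exact (natDegree_C_mul_le _ _).trans hd'deg
    · exact (natDegree_C_mul_le _ _).trans (Fpoly_natDegree _ _ _)
  have hSorth : ∀ j ≤ n, 1 ≤ j → L (S * (X^j * (1-X)^(n-j))) = 0 := by
    intro j hj hj1
    obtain ⟨k, rfl⟩ : ∃ k, j = k + 1 := ⟨j - 1, by omega⟩
    have hFz : L (F * (X^(k+1) * (1-X)^(n-(k+1)))) = 0 := by
      rw [hF, Fpoly_moment hα hβ L hL n _ (by linarith) _ hj]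
      rw [show α + 1 - (α + 1 + ((n - (k+1) : ℕ):ℝ)) = -((n-(k+1) : ℕ) : ℝ) by ring,
        poch_neg_eq_zero _ _ (by omega)]
      simp
    have e : S * (X^(k+1) * (1-X)^(n-(k+1))) =
        ((1-X) * derivative (D i) - C ((n:ℝ) - i + α + 1) * D i) * (X^(k+1) * (1-X)^(n-(k+1)))
        - c • (d' * (X^(k+1) * (1-X)^(n-(k+1)))) + A • (F * (X^(k+1) * (1-X)^(n-(k+1)))) := by
      rw [hS, smul_eq_C_mul, smul_eq_C_mul]; ring
    rw [e, map_add, map_sub, map_smul, map_smul, hFz, adjoint_comp hα hβ L hL n i k hj, hd i hi _ hj, hd i hi _ (by omega)]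
    have h2 := hd' _ hj
    have h3 : c * L (d' * (X^(k+1) * (1-X)^(n-(k+1)))) = (((i:ℝ)+β+1)/((i:ℝ)+1)) * (((i:ℝ)-n) * if k + 1 = i+1 then 1 / (n.choose (i+1) : ℝ) else 0) := by
      rw [← h2, hc]; ring
    simp only [smul_eq_mul]
    rw [h3]
    by_cases hki : k = i
    · subst hki
      have hch : (n.choose k : ℝ) ≠ 0 := by exact_mod_cast (Nat.choose_pos hi).ne'
      have hch1 : (n.choose (k+1) : ℝ) ≠ 0 := by exact_mod_cast (Nat.choose_pos hj).ne'
      have hr : (n.choose (k+1) : ℝ) * (k+1) = n.choose k * (n - k) := by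
        have := congrArg (Nat.cast (R := ℝ)) (Nat.choose_succ_right_eq n k)
        push_cast [Nat.cast_sub hi] at this
        exact this
      simp
      field_simp
      linear_combination (-(k+β+1)) * hr
    · by_cases hki2 : k + 1 = i
      · subst hki2; simp
      · simp [hki, hki2]
  have hS1 : S.eval 1 = 0 := by
    have hE_i : t * (D i).eval 1 = (-1)^(n-i) * poch (β+i+1) (n-i) / poch (α+2) (n-i) := by
      rw [← hE1 _ (hdeg i hi), hEd i hi _ (hd i hi)]
    have hα1 : 0 < α + 1 := by linarith
    have q1 := (poch_pos' hα1 n).ne'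
    have q2 := (poch_pos' hα1 (n-i)).ne'
    have q3 := (poch_pos' (show 0 < β+1 by linarith) i).ne'
    have q4 := (poch_pos' (show 0 < β+i+1 by linarith) (n-i)).ne'
    have q5 := (poch_pos' (show 0 < α+β+2 by linarith) n).ne'
    have q6 : (Nat.factorial n : ℝ) ≠ 0 := by positivity
    have q7 : α + 1 + n ≠ 0 := by positivity
    have hni : (0:ℝ) ≤ n - i := by
      have : (i:ℝ) ≤ n := by exact_mod_cast hi
      linarith
    have q8 : α + 1 + (n - i) ≠ 0 := by positivity
    have r : ∀ m : ℕ, poch (α+2) m = poch (α+1) m * (α+1+m) / (α+1) := by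
      intro m
      rw [← poch_succ', poch_succ_left, show α+1+1 = α+2 by ring]; field_simp
    have rb : poch (β+1) n = poch (β+1) i * poch (β+i+1) (n-i) := by
      conv_lhs => rw [show n = i + (n-i) by omega, poch_add']
      rw [show β+1+(i:ℝ) = β+i+1 by ring]
    have hE_i' : t * (D i).eval 1 = (-1)^(n-i) * poch (β+i+1) (n-i) * (α+1) / (poch (α+1) (n-i) * (α+1+(n-i))) := by
      rw [hE_i, r, Nat.cast_sub hi]; field_simp
    have hE_d : t * (c * d'.eval 1) = ((n:ℝ)-i)/(i+1) * ((-1)^(n-i) * poch (β+i+1) (n-i) * (α+1) / poch (α+1) (n-i)) := by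
      rcases hd'1 with h | ⟨h, h'⟩
      · rw [hc, h]; simp
      · have := hE1 _ hd'deg
        rw [h', hEd (i+1) h _ (hd _ h)] at this
        rw [mul_left_comm, h', ← this, hc]
        obtain ⟨m, hm⟩ : ∃ m, n - i = m + 1 := ⟨n - i - 1, by omega⟩
        rw [show n - (i+1) = m by omega, hm, poch_succ_left (β+i+1), poch_succ_left (α+1),
          show β + ((i+1:ℕ):ℝ) + 1 = β+i+1+1 by push_cast; ring, show α+1+1 = α+2 by ring]
        have := (poch_pos' (show 0 < α+2 by linarith) m).ne'
        field_simp
        ring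
    have hSe : S.eval 1 = -((n:ℝ) - i + α + 1) * (D i).eval 1 - c * d'.eval 1 + A := by
      simp only [hS, eval_add, eval_sub, eval_mul, eval_C, eval_one, eval_X, hF, Fpoly_eval_one]
      ring
    have : t * S.eval 1 = 0 := by
      have e : t * S.eval 1 = -((n:ℝ) - i + α + 1) * (t * (D i).eval 1) - t * (c * d'.eval 1) + t * A := by
        rw [hSe]; ring
      rw [e, hE_i', hE_d, ht, hA, r n, rb]
      field_simp
      ring
    simpa [htpos.ne'] using this
  -- conclude
  have hs : L (S * (1-X)^n) = 0 := by
    have h1 := pair_eval_zero L n S hSorth E hEdeg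
    rw [hE1 S hSdeg, hS1] at h1
    have h1 : L (S * (1-X)^n) * E.eval 0 = 0 := by rw [← h1]; simp
    simpa [hE0] using h1
  obtain ⟨s, hs'⟩ := bern_span n S hSdeg
  have hs0 : ∀ j ∈ Finset.range (n+1), s j = 0 := by
    intro j hj
    have hj : j ≤ n := by simp at hj; omega
    have h1 := pair_eval_zero L n S hSorth (D j) (hdeg j hj)
    rw [hs, zero_mul, hs', Finset.sum_mul, map_sum, Finset.sum_eq_single j] at h1
    · rw [show C (s j) * (X^j * (1-X)^(n-j)) * D j = s j • (D j * (X^j * (1-X)^(n-j))) by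
        rw [smul_eq_C_mul]; ring, map_smul, hd j hj j hj] at h1
      have hch : (n.choose j : ℝ) ≠ 0 := by exact_mod_cast (Nat.choose_pos hj).ne'
      simpa [hch] using h1
    · intro m hm hmj
      have hm : m ≤ n := by simp at hm; omega
      rw [show C (s m) * (X^m * (1-X)^(n-m)) * D j = s m • (D j * (X^m * (1-X)^(n-m))) by
        rw [smul_eq_C_mul]; ring, map_smul, hd j hj m hm, if_neg hmj]
      simp
    · intro h; simp at h; omega
  rw [hs']
  apply Finset.sum_eq_zero
  intro j hj
  rw [hs0 j hj]; simp
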